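/- (𝔸₁, ≪) is a bounded complete lattice: for all x, y ∈ 𝔸₁, x ∇ y is the least upper bound of x and y for the computational order ≪; and every nonempty subset A of 𝔸₁ that has an upper bound for ≪ admits a least upper bound in 𝔸₁ for ≪. -/

import Mathlib

open scoped BigOperators

/-- A generalized affine form: an `ℓ¹` family of noise coefficients `α` together with a
perturbation coefficient `β`. -/
structure AffineForm where
  α : ℕ → ℝ
  β : ℝ
  hsum : Summable fun i => |α i|

namespace AffineForm

/-- `ℓ¹` distance between the `α`-parts of two forms. -/
noncomputable def distL (x y : AffineForm) : ℝ := ∑' i, |x.α i - y.α i|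

/-- `ℓ¹` norm of the `α`-part. -/
noncomputable def normA (x : AffineForm) : ℝ := ∑' i, |x.α i|

/-- Total deviation of the noise part (indices `i ≥ 1`). -/
noncomputable def dev (x : AffineForm) : ℝ := ∑' i, |x.α (i + 1)|

/-- The perturbation order: `x ≤ y` iff `‖αˣ - αʸ‖₁ ≤ βʸ - βˣ`. -/
def le (x y : AffineForm) : Prop := distL x y ≤ y.β - x.β

/-- Lower bound of the concretization. -/
noncomputable def lo (x : AffineForm) : ℝ := x.α 0 - dev x - x.β

/-- Upper bound of the concretization. -/
noncomputable def hi (x : AffineForm) : ℝ := x.α 0 + dev x + x.β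

/-- The concretization interval. -/
noncomputable def γ (x : AffineForm) : Set ℝ := Set.Icc (lo x) (hi x)

/-- Point of `[min a b, max a b]` of minimal absolute value. -/
noncomputable def argmin (a b : ℝ) : ℝ :=
  if a * b ≤ 0 then 0 else if |a| ≤ |b| then a else b

lemma abs_argmin_le (a b : ℝ) : |argmin a b| ≤ |a| + |b| := by
  unfold argmin
  split_ifs with h1 h2
  · simpa using add_nonneg (abs_nonneg a) (abs_nonneg b)
  · linarith [abs_nonneg b]
  · linarith [abs_nonneg a]

/-- The widening `x ∇ y`. -/
noncomputable def widen (x y : AffineForm) : AffineForm where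
  α := fun i =>
    if i = 0 then (min (lo x) (lo y) + max (hi x) (hi y)) / 2
    else argmin (x.α i) (y.α i)
  β := max (hi x) (hi y) - (min (lo x) (lo y) + max (hi x) (hi y)) / 2
        - ∑' i, |argmin (x.α (i + 1)) (y.α (i + 1))|
  hsum := by
    have hc : Summable fun i : ℕ =>
        (if i = 0 then |(min (lo x) (lo y) + max (hi x) (hi y)) / 2| else 0 : ℝ) :=
      summable_of_ne_finset_zero (s := {0}) (by
        intro i hi
        simp only [Finset.mem_singleton] at hi
        simp [hi])
    refine Summable.of_nonneg_of_le (fun i => abs_nonneg _) (fun i => ?_)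
      ((x.hsum.add y.hsum).add hc)
    by_cases h0 : i = 0
    · subst h0
      simp only [reduceIte]
      linarith [abs_nonneg (x.α 0), abs_nonneg (y.α 0)]
    · simp only [if_neg h0, add_zero]
      exact abs_argmin_le _ _

/-- The computational order: `x ≪ y` iff `x ∇ y = y`. -/
def ll (x y : AffineForm) : Prop := widen x y = y

/-- `b` lies between `0` and `a`. -/
def Shrinks (a b : ℝ) : Prop := (0 ≤ b ∧ b ≤ a) ∨ (a ≤ b ∧ b ≤ 0)

lemma Shrinks.abs_le {a b : ℝ} (h : Shrinks a b) : |b| ≤ |a| := by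
  rcases h with ⟨h1, h2⟩ | ⟨h1, h2⟩
  · rwa [abs_of_nonneg h1, abs_of_nonneg (h1.trans h2)]
  · rw [abs_of_nonpos h2, abs_of_nonpos (h1.trans h2)]
    linarith

/-- `argmin` by the signs of its arguments. -/
lemma argmin_cases (a b : ℝ) :
    (0 < a ∧ 0 < b ∧ argmin a b = min a b) ∨ (a < 0 ∧ b < 0 ∧ argmin a b = max a b) ∨
      (((a ≤ 0 ∧ 0 ≤ b) ∨ (0 ≤ a ∧ b ≤ 0)) ∧ argmin a b = 0) := by
  unfold argmin
  by_cases h : a * b ≤ 0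
  · rw [if_pos h]
    exact Or.inr (Or.inr ⟨(mul_nonpos_iff.1 h).symm, rfl⟩)
  · rw [if_neg h]
    rcases mul_pos_iff.1 (not_le.1 h) with ⟨ha, hb⟩ | ⟨ha, hb⟩
    · refine Or.inl ⟨ha, hb, ?_⟩
      rw [abs_of_pos ha, abs_of_pos hb, min_def]
    · refine Or.inr (Or.inl ⟨ha, hb, ?_⟩)
      simp only [abs_of_neg ha, abs_of_neg hb, neg_le_neg_iff, max_comm a b, max_def]

lemma argmin_eq_right_iff {a b : ℝ} : argmin a b = b ↔ Shrinks a b := by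
  unfold Shrinks
  rcases argmin_cases a b with h | h | h <;> grind

lemma shrinks_argmin_left (a b : ℝ) : Shrinks a (argmin a b) := by
  unfold Shrinks
  rcases argmin_cases a b with h | h | h <;> grind

lemma shrinks_argmin_right (a b : ℝ) : Shrinks b (argmin a b) := by
  unfold Shrinks
  rcases argmin_cases a b with h | h | h <;> grind

lemma Shrinks.argmin {a b u : ℝ} (ha : Shrinks a u) (hb : Shrinks b u) :
    Shrinks (argmin a b) u := by
  unfold Shrinks at *
  rcases argmin_cases a b with h | h | h <;> grind

/-- Every nonempty set of reals has a least upper bound for `Shrinks`. -/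
lemma exists_lub_shrinks {S : Set ℝ} (hS : S.Nonempty) :
    ∃ m, (∀ a ∈ S, Shrinks a m) ∧ ∀ u, (∀ a ∈ S, Shrinks a u) → Shrinks m u := by
  obtain ⟨s, hs⟩ := hS
  by_cases hpos : ∀ a ∈ S, 0 ≤ a
  · have hle : ∀ a ∈ S, sInf S ≤ a := fun a ha => csInf_le ⟨0, hpos⟩ ha
    have h0 : 0 ≤ sInf S := le_csInf ⟨s, hs⟩ hpos
    refine ⟨sInf S, fun a ha => Or.inl ⟨h0, hle a ha⟩, fun u hu => ?_⟩
    have hu0 : 0 ≤ u := by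
      rcases hu s hs with h | h
      · exact h.1
      · exact (hpos s hs).trans h.1
    refine Or.inl ⟨hu0, le_csInf ⟨s, hs⟩ fun a ha => ?_⟩
    rcases hu a ha with h | h
    · exact h.2
    · exact h.2.trans (hpos a ha)
  by_cases hneg : ∀ a ∈ S, a ≤ 0
  · have hle : ∀ a ∈ S, a ≤ sSup S := fun a ha => le_csSup ⟨0, hneg⟩ ha
    have h0 : sSup S ≤ 0 := csSup_le ⟨s, hs⟩ hneg
    refine ⟨sSup S, fun a ha => Or.inr ⟨hle a ha, h0⟩, fun u hu => ?_⟩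
    have hu0 : u ≤ 0 := by
      rcases hu s hs with h | h
      · exact h.2.trans (hneg s hs)
      · exact h.2
    refine Or.inr ⟨csSup_le ⟨s, hs⟩ fun a ha => ?_, hu0⟩
    rcases hu a ha with h | h
    · exact (hneg a ha).trans h.1
    · exact h.1
  push Not at hpos hneg
  obtain ⟨p, hp, hp0⟩ := hpos
  obtain ⟨q, hq, hq0⟩ := hneg
  refine ⟨0, fun a _ => ?_, fun u hu => ?_⟩
  · rcases le_total 0 a with h | h
    · exact Or.inl ⟨le_rfl, h⟩
    · exact Or.inr ⟨h, le_rfl⟩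
  · have h1 := hu p hp
    have h2 := hu q hq
    unfold Shrinks at *
    grind

@[ext]
lemma ext {x y : AffineForm} (hα : x.α = y.α) (hβ : x.β = y.β) : x = y := by
  cases x
  cases y
  simp_all

lemma lo_widen (x y : AffineForm) : lo (widen x y) = min (lo x) (lo y) := by
  have h : dev (widen x y) = ∑' i, |argmin (x.α (i + 1)) (y.α (i + 1))| := by
    simp [dev, widen]
  rw [lo, h]
  simp only [widen, reduceIte]
  ring

lemma hi_widen (x y : AffineForm) : hi (widen x y) = max (hi x) (hi y) := by
  have h : dev (widen x y) = ∑' i, |argmin (x.α (i + 1)) (y.α (i + 1))| := by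
    simp [dev, widen]
  rw [hi, h]
  simp only [widen, reduceIte]
  ring

lemma α_widen_succ (x y : AffineForm) (i : ℕ) :
    (widen x y).α (i + 1) = argmin (x.α (i + 1)) (y.α (i + 1)) := by
  simp [widen]

/-- A form is determined by the bounds of its concretization and its noise coefficients of
positive index. -/
lemma eq_of_lo_of_hi_of_α_succ {x y : AffineForm} (hlo : lo x = lo y) (hhi : hi x = hi y)
    (hα : ∀ i, x.α (i + 1) = y.α (i + 1)) : x = y := by
  have hdev : dev x = dev y := by simp only [dev, hα]
  unfold lo at hlo
  unfold hi at hhi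
  ext i
  · cases i with
    | zero => linarith
    | succ i => exact hα i
  · linarith

lemma ll_iff {x y : AffineForm} :
    ll x y ↔ lo y ≤ lo x ∧ hi x ≤ hi y ∧ ∀ i, Shrinks (x.α (i + 1)) (y.α (i + 1)) := by
  constructor
  · intro h
    refine ⟨?_, ?_, fun i => ?_⟩
    · rw [← min_eq_right_iff, ← lo_widen, h]
    · rw [← max_eq_right_iff, ← hi_widen, h]
    · rw [← argmin_eq_right_iff, ← α_widen_succ, h]
  · rintro ⟨h1, h2, h3⟩
    refine eq_of_lo_of_hi_of_α_succ ?_ ?_ fun i => ?_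
    · rw [lo_widen, min_eq_right h1]
    · rw [hi_widen, max_eq_right h2]
    · rw [α_widen_succ, argmin_eq_right_iff.2 (h3 i)]

/-- Concretization bounds and summable noise coefficients can be prescribed freely. -/
lemma exists_lo_hi_α_succ (l h : ℝ) {m : ℕ → ℝ} (hm : Summable fun i => |m i|) :
    ∃ z : AffineForm, lo z = l ∧ hi z = h ∧ ∀ i, z.α (i + 1) = m i := by
  let z : AffineForm :=
    { α := fun i => Nat.casesOn i ((l + h) / 2) m
      β := (h - l) / 2 - ∑' i, |m i|
      hsum := (summable_nat_add_iff 1).1 hm }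
  have hdev : dev z = ∑' i, |m i| := rfl
  refine ⟨z, ?_, ?_, fun i => rfl⟩
  · rw [lo, hdev]
    change (l + h) / 2 - _ - ((h - l) / 2 - _) = l
    ring
  · rw [hi, hdev]
    change (l + h) / 2 + _ + ((h - l) / 2 - _) = h
    ring

lemma exists_lub_ll {A : Set AffineForm} (hA : A.Nonempty) (hb : ∃ b, ∀ a ∈ A, ll a b) :
    ∃ z, (∀ a ∈ A, ll a z) ∧ ∀ u, (∀ a ∈ A, ll a u) → ll z u := by
  obtain ⟨b, hb⟩ := hb
  choose m hm_ub hm_least using fun i : ℕ =>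
    exists_lub_shrinks (hA.image fun a : AffineForm => a.α (i + 1))
  simp only [Set.forall_mem_image] at hm_ub hm_least
  have hm : Summable fun i => |m i| := by
    obtain ⟨a, ha⟩ := hA
    exact Summable.of_nonneg_of_le (fun i => abs_nonneg _) (fun i => (hm_ub i ha).abs_le)
      ((summable_nat_add_iff 1).2 a.hsum)
  have hbelow : BddBelow (lo '' A) :=
    ⟨lo b, Set.forall_mem_image.2 fun a ha => (ll_iff.1 (hb a ha)).1⟩
  have habove : BddAbove (hi '' A) :=
    ⟨hi b, Set.forall_mem_image.2 fun a ha => (ll_iff.1 (hb a ha)).2.1⟩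
  obtain ⟨z, hlo, hhi, hα⟩ := exists_lo_hi_α_succ (sInf (lo '' A)) (sSup (hi '' A)) hm
  refine ⟨z, fun a ha => ll_iff.2 ⟨?_, ?_, fun i => ?_⟩,
    fun u hu => ll_iff.2 ⟨?_, ?_, fun i => ?_⟩⟩
  · exact hlo ▸ csInf_le hbelow (Set.mem_image_of_mem _ ha)
  · exact hhi ▸ le_csSup habove (Set.mem_image_of_mem _ ha)
  · exact hα i ▸ hm_ub i ha
  · exact hlo ▸ le_csInf (hA.image _)
      (Set.forall_mem_image.2 fun a ha => (ll_iff.1 (hu a ha)).1)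
  · exact hhi ▸ csSup_le (hA.image _)
      (Set.forall_mem_image.2 fun a ha => (ll_iff.1 (hu a ha)).2.1)
  · exact hα i ▸ hm_least i _ fun a ha => (ll_iff.1 (hu a ha)).2.2 i

/-- `(𝔸₁, ≪)` is a bounded complete lattice: `x ∇ y` is the least upper bound of `x`
and `y`, and every nonempty subset bounded above admits a least upper bound. -/
theorem ll_bounded_complete_lattice :
    (∀ x y : AffineForm, ll x (widen x y) ∧ ll y (widen x y) ∧
      ∀ u, ll x u → ll y u → ll (widen x y) u) ∧
    (∀ A : Set AffineForm, A.Nonempty → (∃ b, ∀ a ∈ A, ll a b) →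
      ∃ z, (∀ a ∈ A, ll a z) ∧ ∀ u, (∀ a ∈ A, ll a u) → ll z u) := by
  refine ⟨fun x y => ⟨ll_iff.2 ⟨?_, ?_, fun i => ?_⟩, ll_iff.2 ⟨?_, ?_, fun i => ?_⟩,
    fun u hx hy => ?_⟩, fun A => exists_lub_ll⟩
  · exact lo_widen x y ▸ min_le_left _ _
  · exact hi_widen x y ▸ le_max_left _ _
  · exact α_widen_succ x y i ▸ shrinks_argmin_left _ _
  · exact lo_widen x y ▸ min_le_right _ _
  · exact hi_widen x y ▸ le_max_right _ _
  · exact α_widen_succ x y i ▸ shrinks_argmin_right _ _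
  · obtain ⟨hx1, hx2, hx3⟩ := ll_iff.1 hx
    obtain ⟨hy1, hy2, hy3⟩ := ll_iff.1 hy
    exact ll_iff.2 ⟨lo_widen x y ▸ le_min hx1 hy1, hi_widen x y ▸ max_le hx2 hy2,
      fun i => α_widen_succ x y i ▸ (hx3 i).argmin (hy3 i)⟩

end AffineForm
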